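/- arXiv:math/0702446 — 2 statements merged into one kernel-verified Lean document; each statement's English description precedes it below -/
import Mathlib

section
/- There exists a unique probability measure μ on [0,1] such that ∫₀¹ tⁿ dμ(t) = m_n for all n ≥ 0, where (m_n) is the fixed point sequence. Moreover this measure satisfies μ({0}) = 0 and μ({1}) = 0. -/
open MeasureTheory Set

/-- The fixed point sequence: `m 0 = 1`,
`m (n+1) = (-1 + √(1 + 4 mₙ²))/(2 mₙ)`. -/
noncomputable def fpSeq : ℕ → ℝ
  | 0 => 1
  | n + 1 => (-1 + Real.sqrt (1 + 4 * fpSeq n ^ 2)) / (2 * fpSeq n)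

open Filter Polynomial
open scoped Topology unitInterval

/-- The sequence `a` has nonnegative alternating differences up to order `k`. -/
def IsMonotoneOfOrder : ℕ → (ℕ → ℝ) → Prop
  | 0, a => ∀ n, 0 ≤ a n
  | k + 1, a => (∀ n, 0 ≤ a n) ∧ IsMonotoneOfOrder k fun n => a n - a (n + 1)

namespace IsMonotoneOfOrder

theorem nonneg {k : ℕ} {a : ℕ → ℝ} (h : IsMonotoneOfOrder k a) (n : ℕ) : 0 ≤ a n := by
  cases k with
  | zero => exact h n
  | succ k => exact h.1 n

theorem of_succ {k : ℕ} {a : ℕ → ℝ} (h : IsMonotoneOfOrder (k + 1) a) :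
    IsMonotoneOfOrder k a := by
  induction k generalizing a with
  | zero => exact h.1
  | succ k ih => exact ⟨h.1, ih h.2⟩

theorem shift {k : ℕ} {a : ℕ → ℝ} (h : IsMonotoneOfOrder k a) :
    IsMonotoneOfOrder k fun n => a (n + 1) := by
  induction k generalizing a with
  | zero => exact fun n => h (n + 1)
  | succ k ih => exact ⟨fun n => h.1 (n + 1), ih h.2⟩

theorem add {k : ℕ} {a b : ℕ → ℝ} (ha : IsMonotoneOfOrder k a) (hb : IsMonotoneOfOrder k b) :
    IsMonotoneOfOrder k fun n => a n + b n := by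
  induction k generalizing a b with
  | zero => exact fun n => add_nonneg (ha n) (hb n)
  | succ k ih =>
    refine ⟨fun n => add_nonneg (ha.1 n) (hb.1 n), ?_⟩
    convert ih ha.2 hb.2 using 2
    ring

theorem mul {k : ℕ} {a b : ℕ → ℝ} (ha : IsMonotoneOfOrder k a) (hb : IsMonotoneOfOrder k b) :
    IsMonotoneOfOrder k fun n => a n * b n := by
  induction k generalizing a b with
  | zero => exact fun n => mul_nonneg (ha n) (hb n)
  | succ k ih =>
    refine ⟨fun n => mul_nonneg (ha.1 n) (hb.1 n), ?_⟩
    convert (ih ha.2 hb.of_succ).add (ih ha.of_succ.shift hb.2) using 2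
    ring

end IsMonotoneOfOrder

theorem fpSeq_pos (n : ℕ) : 0 < fpSeq n := by
  induction n with
  | zero => simp [fpSeq]
  | succ n ih =>
    rw [fpSeq]
    have : 1 < √(1 + 4 * fpSeq n ^ 2) := by
      rw [Real.lt_sqrt zero_le_one]
      nlinarith [pow_pos ih 2]
    exact div_pos (by linarith) (by linarith)

theorem fpSeq_sub_succ (n : ℕ) :
    fpSeq n - fpSeq (n + 1) = fpSeq n * (fpSeq (n + 1) * fpSeq (n + 1)) := by
  have hpos := fpSeq_pos n
  have hsq : √(1 + 4 * fpSeq n ^ 2) ^ 2 = 1 + 4 * fpSeq n ^ 2 := Real.sq_sqrt (by positivity)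
  rw [fpSeq]
  generalize √(1 + 4 * fpSeq n ^ 2) = s at hsq
  field_simp
  linear_combination -hsq

theorem fpSeq_isMonotoneOfOrder (k : ℕ) : IsMonotoneOfOrder k fpSeq := by
  induction k with
  | zero => exact fun n => (fpSeq_pos n).le
  | succ k ih =>
    refine ⟨fun n => (fpSeq_pos n).le, ?_⟩
    simp_rw [fpSeq_sub_succ]
    exact ih.mul (ih.shift.mul ih.shift)

theorem fpSeq_one_lt_one : fpSeq 1 < 1 := by
  have h := fpSeq_sub_succ 0
  have h0 : fpSeq 0 = 1 := rfl
  rw [zero_add, h0] at h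
  nlinarith [fpSeq_pos 1]

theorem tendsto_fpSeq : Tendsto fpSeq atTop (𝓝 0) := by
  have hanti : Antitone fpSeq := antitone_nat_of_succ_le fun n => by
    have := fpSeq_sub_succ n
    have := fpSeq_pos n
    have := fpSeq_pos (n + 1)
    have : 0 < fpSeq n * (fpSeq (n + 1) * fpSeq (n + 1)) := by positivity
    linarith
  have hlim := tendsto_atTop_ciInf hanti ⟨0, by rintro _ ⟨n, rfl⟩; exact (fpSeq_pos n).le⟩
  generalize (⨅ n, fpSeq n) = l at hlim
  have hsucc := hlim.comp (tendsto_add_atTop_nat 1)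
  have heq : l - l = l * (l * l) := by
    refine tendsto_nhds_unique (hlim.sub hsucc) ?_
    convert hlim.mul (hsucc.mul hsucc) using 2
    simp [fpSeq_sub_succ]
  have hl : l = 0 := by
    have : l ^ 3 = 0 := by linear_combination -heq
    simpa using this
  rwa [hl] at hlim

/-- The linear functional on polynomials sending `X ^ n` to `a n`. -/
noncomputable def momentFunctional (a : ℕ → ℝ) : ℝ[X] →ₗ[ℝ] ℝ :=
  Polynomial.lsum fun n => LinearMap.id.smulRight (a n)

theorem momentFunctional_monomial (a : ℕ → ℝ) (n : ℕ) (c : ℝ) :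
    momentFunctional a (monomial n c) = c * a n := by
  simp [momentFunctional, Polynomial.lsum_apply, Polynomial.sum_monomial_index]

theorem momentFunctional_X_pow (a : ℕ → ℝ) (n : ℕ) : momentFunctional a (X ^ n) = a n := by
  rw [← monomial_one_right_eq_X_pow, momentFunctional_monomial, one_mul]

theorem momentFunctional_mul_one_sub_X (a : ℕ → ℝ) (p : ℝ[X]) :
    momentFunctional a (p * (1 - X)) = momentFunctional (fun n => a n - a (n + 1)) p := by
  induction p using Polynomial.induction_on' with
  | add p q hp hq => rw [add_mul, map_add, map_add, hp, hq]
  | monomial n c =>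
    rw [mul_sub, mul_one, monomial_mul_X, map_sub]
    simp_rw [momentFunctional_monomial]
    ring

theorem IsMonotoneOfOrder.momentFunctional_nonneg {k : ℕ} {a : ℕ → ℝ}
    (h : IsMonotoneOfOrder k a) (n : ℕ) : 0 ≤ momentFunctional a (X ^ n * (1 - X) ^ k) := by
  induction k generalizing a with
  | zero => simpa [momentFunctional_X_pow] using h n
  | succ k ih =>
    rw [pow_succ, ← mul_assoc, momentFunctional_mul_one_sub_X]
    exact ih h.2

theorem IsMonotoneOfOrder.momentFunctional_bernsteinPolynomial_nonneg {a : ℕ → ℝ}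
    (h : ∀ k, IsMonotoneOfOrder k a) (N k : ℕ) :
    0 ≤ momentFunctional a (bernsteinPolynomial ℝ N k) := by
  have : bernsteinPolynomial ℝ N k = (N.choose k : ℝ) • (X ^ k * (1 - X) ^ (N - k)) := by
    rw [bernsteinPolynomial, smul_eq_C_mul, C_eq_natCast, mul_assoc]
  rw [this, map_smul]
  exact mul_nonneg (Nat.cast_nonneg _) ((h _).momentFunctional_nonneg k)

theorem bernsteinPolynomial_sum_choose (n M : ℕ) :
    ∑ k ∈ Finset.range (n + M + 1), (k.choose n : ℝ[X]) * bernsteinPolynomial ℝ (n + M) k =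
      ((n + M).choose n : ℝ[X]) * X ^ n := by
  have hz : ∑ k ∈ Finset.range n, (k.choose n : ℝ[X]) * bernsteinPolynomial ℝ (n + M) k = 0 :=
    Finset.sum_eq_zero fun k hk => by
      rw [Nat.choose_eq_zero_of_lt (Finset.mem_range.1 hk), Nat.cast_zero, zero_mul]
  have hterm (j : ℕ) (hj : j ∈ Finset.range (M + 1)) :
      ((n + j).choose n : ℝ[X]) * bernsteinPolynomial ℝ (n + M) (n + j) =
        ((n + M).choose n : ℝ[X]) * X ^ n * bernsteinPolynomial ℝ M j := by
    have hjM : j ≤ M := Nat.lt_succ_iff.1 (Finset.mem_range.1 hj)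
    have hc : (((n + M).choose (n + j) : ℕ) : ℝ[X]) * ((n + j).choose n : ℕ) =
        ((n + M).choose n : ℕ) * (M.choose j : ℕ) := by
      have := Nat.choose_mul (n := n + M) (k := n + j) (s := n) (by omega)
      simp only [Nat.add_sub_cancel_left] at this
      exact_mod_cast this
    rw [bernsteinPolynomial, bernsteinPolynomial, Nat.add_sub_add_left, pow_add]
    linear_combination (X ^ n * X ^ j * (1 - X) ^ (M - j)) * hc
  rw [add_assoc, Finset.sum_range_add, hz, zero_add, Finset.sum_congr rfl hterm,
    ← Finset.mul_sum, bernsteinPolynomial.sum, mul_one]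

theorem bernsteinPolynomial_sum_descFactorial {n N : ℕ} (h : n ≤ N) :
    ∑ k ∈ Finset.range (N + 1), (k.descFactorial n : ℝ) • bernsteinPolynomial ℝ N k =
      (N.descFactorial n : ℝ) • X ^ n := by
  obtain ⟨M, rfl⟩ := Nat.exists_eq_add_of_le h
  have := congrArg (fun p => (n.factorial : ℝ[X]) * p) (bernsteinPolynomial_sum_choose n M)
  simp only [Finset.mul_sum, ← mul_assoc, ← Nat.cast_mul,
    ← Nat.descFactorial_eq_factorial_mul_choose] at this
  simpa only [smul_eq_C_mul, C_eq_natCast, map_natCast] using this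

theorem abs_pow_sub_descFactorial_le {k N : ℕ} (h : k ≤ N) (n : ℕ) :
    N * |(k : ℝ) ^ n - k.descFactorial n| ≤ n ^ 2 * N ^ n := by
  have hk : (k : ℝ) ≤ N := by exact_mod_cast h
  induction n with
  | zero => simp
  | succ n ih =>
    have hd : ((k.descFactorial (n + 1) : ℕ) : ℝ) = (k - n) * k.descFactorial n := by
      rw [Nat.descFactorial_succ, Nat.cast_mul]
      rcases le_or_gt n k with hn | hn
      · rw [Nat.cast_sub hn]
      · simp [Nat.descFactorial_eq_zero_iff_lt.2 hn]
    have hle : (k.descFactorial n : ℝ) ≤ N ^ n := by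
      exact_mod_cast (Nat.descFactorial_le_pow k n).trans (Nat.pow_le_pow_left h n)
    have hsplit : (k : ℝ) ^ (n + 1) - k.descFactorial (n + 1) =
        k * (k ^ n - k.descFactorial n) + n * k.descFactorial n := by rw [hd]; ring
    calc (N : ℝ) * |(k : ℝ) ^ (n + 1) - k.descFactorial (n + 1)|
        ≤ N * (k * |(k : ℝ) ^ n - k.descFactorial n| + n * k.descFactorial n) := by
          rw [hsplit]
          gcongr
          refine (abs_add_le _ _).trans_eq ?_
          rw [abs_mul, Nat.abs_cast, abs_of_nonneg (by positivity : (0:ℝ) ≤ n * k.descFactorial n)]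
      _ = k * (N * |(k : ℝ) ^ n - k.descFactorial n|) + N * (n * k.descFactorial n) := by ring
      _ ≤ N * (n ^ 2 * N ^ n) + N * (n * N ^ n) := by gcongr
      _ = (n ^ 2 + n) * N ^ (n + 1) := by ring
      _ ≤ ((n + 1 : ℕ) : ℝ) ^ 2 * N ^ (n + 1) := by
          gcongr
          push_cast
          nlinarith [(Nat.cast_nonneg n : (0:ℝ) ≤ n)]

/-- The Bernstein weights of a completely monotone sequence `a` have moments converging
to `a`. -/
theorem tendsto_sum_momentFunctional_bernsteinPolynomial {a : ℕ → ℝ}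
    (h : ∀ k, IsMonotoneOfOrder k a) (n : ℕ) :
    Tendsto (fun N : ℕ => ∑ k ∈ Finset.range (N + 1),
      momentFunctional a (bernsteinPolynomial ℝ N k) * ((k : ℝ) / N) ^ n) atTop (𝓝 (a n)) := by
  have hbound : ∀ᶠ N : ℕ in atTop, ‖∑ k ∈ Finset.range (N + 1),
      momentFunctional a (bernsteinPolynomial ℝ N k) * ((k : ℝ) / N) ^ n - a n‖ ≤
        (n ^ 2 * (a 0 + a n)) / N := by
    filter_upwards [eventually_ge_atTop n, eventually_gt_atTop 0] with N hn hN
    have hN' : (0 : ℝ) < N := by exact_mod_cast hN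
    set w := fun k => momentFunctional a (bernsteinPolynomial ℝ N k) with hw
    have hw0 (k : ℕ) : 0 ≤ w k :=
      IsMonotoneOfOrder.momentFunctional_bernsteinPolynomial_nonneg h N k
    have hsum : ∑ k ∈ Finset.range (N + 1), w k = a 0 := by
      rw [hw, ← map_sum, bernsteinPolynomial.sum, ← pow_zero X, momentFunctional_X_pow]
    have hdesc : ∑ k ∈ Finset.range (N + 1), w k * k.descFactorial n =
        N.descFactorial n * a n := by
      have := congrArg (momentFunctional a) (bernsteinPolynomial_sum_descFactorial hn)
      rw [map_sum, map_smul, momentFunctional_X_pow] at this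
      simpa only [map_smul, smul_eq_mul, mul_comm (w _)] using this
    have hsplit : (N : ℝ) ^ n * (∑ k ∈ Finset.range (N + 1), w k * ((k : ℝ) / N) ^ n - a n) =
        ∑ k ∈ Finset.range (N + 1), w k * ((k : ℝ) ^ n - k.descFactorial n) -
          ((N : ℝ) ^ n - N.descFactorial n) * a n := by
      simp_rw [mul_sub, Finset.sum_sub_distrib, hdesc, Finset.mul_sum, div_pow]
      have : ∀ k : ℕ, (N : ℝ) ^ n * (w k * ((k : ℝ) ^ n / N ^ n)) = w k * (k : ℝ) ^ n := by
        intro k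
        field_simp
      simp_rw [this]
      ring
    have hmain : N * |(N : ℝ) ^ n *
        (∑ k ∈ Finset.range (N + 1), w k * ((k : ℝ) / N) ^ n - a n)| ≤
        n ^ 2 * N ^ n * (a 0 + a n) := by
      rw [hsplit]
      calc _ ≤ N * (∑ k ∈ Finset.range (N + 1), |w k * ((k : ℝ) ^ n - k.descFactorial n)| +
              |((N : ℝ) ^ n - N.descFactorial n) * a n|) := by
            gcongr
            exact (abs_sub _ _).trans (by gcongr; exact Finset.abs_sum_le_sum_abs _ _)
        _ = ∑ k ∈ Finset.range (N + 1), w k * (N * |(k : ℝ) ^ n - k.descFactorial n|) +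
              (N * |(N : ℝ) ^ n - N.descFactorial n|) * a n := by
            simp_rw [abs_mul, abs_of_nonneg (hw0 _), abs_of_nonneg ((h 0).nonneg n), mul_add,
              Finset.mul_sum, mul_left_comm (N : ℝ) (w _), mul_assoc]
        _ ≤ ∑ k ∈ Finset.range (N + 1), w k * (n ^ 2 * N ^ n) + n ^ 2 * N ^ n * a n := by
            refine add_le_add (Finset.sum_le_sum fun k hk => ?_) ?_
            · exact mul_le_mul_of_nonneg_left (abs_pow_sub_descFactorial_le
                (Nat.lt_succ_iff.1 (Finset.mem_range.1 hk)) n) (hw0 k)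
            · exact mul_le_mul_of_nonneg_right (abs_pow_sub_descFactorial_le le_rfl n)
                ((h 0).nonneg n)
        _ = _ := by rw [← Finset.sum_mul, hsum]; ring
    rw [Real.norm_eq_abs, le_div_iff₀ hN']
    rw [abs_mul, abs_of_pos (by positivity : (0 : ℝ) < N ^ n)] at hmain
    refine le_of_mul_le_mul_left ?_ (by positivity : (0 : ℝ) < N ^ n)
    linarith
  rw [tendsto_iff_norm_sub_tendsto_zero]
  refine squeeze_zero' (Eventually.of_forall fun _ => norm_nonneg _) hbound ?_
  exact tendsto_const_nhds.div_atTop tendsto_natCast_atTop_atTop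

/-- A probability measure on `[0, 1]` with finitely many prescribed weights at the points
`k / N`. -/
theorem exists_probabilityMeasure_integral_eq_sum (N : ℕ) (w : ℕ → ℝ) (hw : ∀ k, 0 ≤ w k)
    (hsum : ∑ k ∈ Finset.range (N + 1), w k = 1) :
    ∃ μ : ProbabilityMeasure I, ∀ n : ℕ, ∫ t, (t : ℝ) ^ n ∂(μ : Measure I) =
      ∑ k ∈ Finset.range (N + 1), w k * ((k : ℝ) / N) ^ n := by
  let x (k : ℕ) : I := projIcc 0 1 zero_le_one ((k : ℝ) / N)
  have hx {k : ℕ} (hk : k ∈ Finset.range (N + 1)) : (x k : ℝ) = (k : ℝ) / N := by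
    have hkN : (k : ℝ) ≤ N := by exact_mod_cast Nat.lt_succ_iff.1 (Finset.mem_range.1 hk)
    have : (k : ℝ) / N ∈ Icc (0 : ℝ) 1 := ⟨by positivity, div_le_one_of_le₀ hkN (by positivity)⟩
    simp [x, projIcc_of_mem zero_le_one this]
  let μ : Measure I := ∑ k ∈ Finset.range (N + 1), ENNReal.ofReal (w k) • Measure.dirac (x k)
  have hμ : IsProbabilityMeasure μ := ⟨by
    simp only [μ, Measure.coe_finsetSum, Finset.sum_apply, Measure.smul_apply, smul_eq_mul,
      measure_univ, mul_one]
    rw [← ENNReal.ofReal_sum_of_nonneg fun k _ => hw k, hsum, ENNReal.ofReal_one]⟩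
  refine ⟨⟨μ, hμ⟩, fun n => ?_⟩
  change ∫ t, (t : ℝ) ^ n ∂μ = _
  have hint (k : ℕ) : Integrable (fun t : I => (t : ℝ) ^ n)
      (ENNReal.ofReal (w k) • Measure.dirac (x k)) :=
    (integrable_dirac (by finiteness)).smul_measure ENNReal.ofReal_ne_top
  rw [integral_finsetSum_measure fun k _ => hint k]
  refine Finset.sum_congr rfl fun k hk => ?_
  rw [integral_smul_measure, integral_dirac, ENNReal.toReal_ofReal (hw k), hx hk, smul_eq_mul]

/-- **Hausdorff moment theorem**: existence of a representing measure. -/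
theorem exists_probabilityMeasure_moments {a : ℕ → ℝ} (h : ∀ k, IsMonotoneOfOrder k a)
    (h0 : a 0 = 1) :
    ∃ μ : ProbabilityMeasure I, ∀ n : ℕ, ∫ t, (t : ℝ) ^ n ∂(μ : Measure I) = a n := by
  have hex (N : ℕ) := exists_probabilityMeasure_integral_eq_sum N
    (fun k => momentFunctional a (bernsteinPolynomial ℝ N k))
    (IsMonotoneOfOrder.momentFunctional_bernsteinPolynomial_nonneg h N)
    (by rw [← map_sum, bernsteinPolynomial.sum, ← pow_zero X, momentFunctional_X_pow, h0])
  choose μ hμ using hex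
  obtain ⟨ν, -, hν⟩ := isCompact_iff_ultrafilter_le_nhds.1
    (isCompact_univ (X := ProbabilityMeasure I)) ((hyperfilter ℕ).map μ) (by simp)
  refine ⟨ν, fun n => ?_⟩
  have hν' : Tendsto μ (hyperfilter ℕ) (𝓝 ν) := hν
  let f : BoundedContinuousFunction I ℝ :=
    BoundedContinuousFunction.mkOfCompact ⟨fun t => (t : ℝ) ^ n, by fun_prop⟩
  have hlim := (ProbabilityMeasure.tendsto_iff_forall_integral_tendsto.1 hν') f
  refine tendsto_nhds_unique hlim ?_
  have := (tendsto_sum_momentFunctional_bernsteinPolynomial h n).mono_left Nat.hyperfilter_le_atTop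
  exact this.congr fun N => (hμ N n).symm

theorem integrable_of_continuous_of_ae_mem_Icc {μ : Measure ℝ} [IsFiniteMeasure μ]
    (hμ : ∀ᵐ t ∂μ, t ∈ Icc (0 : ℝ) 1) {f : ℝ → ℝ} (hf : Continuous f) : Integrable f μ := by
  rw [← Measure.restrict_eq_self_of_ae_mem hμ]
  exact hf.continuousOn.integrableOn_compact isCompact_Icc

/-- A probability measure on `[0, 1]` is determined by its moments. -/
theorem eq_of_integral_pow_eq {μ ν : Measure ℝ} [IsProbabilityMeasure μ] [IsProbabilityMeasure ν]
    (hμ : ∀ᵐ t ∂μ, t ∈ Icc (0 : ℝ) 1) (hν : ∀ᵐ t ∂ν, t ∈ Icc (0 : ℝ) 1)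
    (h : ∀ n : ℕ, ∫ t, t ^ n ∂μ = ∫ t, t ^ n ∂ν) : μ = ν := by
  have hpoly (p : ℝ[X]) : ∫ t, p.eval t ∂μ = ∫ t, p.eval t ∂ν := by
    induction p using Polynomial.induction_on' with
    | add p q hp hq =>
      simp only [eval_add]
      rw [integral_add, integral_add, hp, hq] <;>
        first
        | exact integrable_of_continuous_of_ae_mem_Icc hμ (Polynomial.continuous _)
        | exact integrable_of_continuous_of_ae_mem_Icc hν (Polynomial.continuous _)
    | monomial n c => simp only [eval_monomial, integral_const_mul, h]
  refine ext_of_forall_integral_eq_of_IsFiniteMeasure fun f => ?_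
  refine eq_of_abs_sub_le_all fun ε hε => ?_
  obtain ⟨p, hp⟩ := exists_polynomial_near_of_continuousOn 0 1 f f.continuous.continuousOn
    (ε / 2) (by positivity)
  have hclose (ρ : Measure ℝ) [IsProbabilityMeasure ρ] (hρ : ∀ᵐ t ∂ρ, t ∈ Icc (0 : ℝ) 1) :
      |∫ t, p.eval t ∂ρ - ∫ t, f t ∂ρ| ≤ ε / 2 := by
    rw [← integral_sub (integrable_of_continuous_of_ae_mem_Icc hρ p.continuous)
      (integrable_of_continuous_of_ae_mem_Icc hρ f.continuous)]
    have := norm_integral_le_of_norm_le_const (μ := ρ) (C := ε / 2)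
      (f := fun t => p.eval t - f t) (by
        filter_upwards [hρ] with t ht
        exact (hp t ht).le)
    simpa using this
  have h1 := abs_le.1 (hclose μ hμ)
  have h2 := abs_le.1 (hclose ν hν)
  rw [hpoly p] at h1
  exact abs_le.2 ⟨by linarith, by linarith⟩

theorem measure_singleton_one_eq_zero {μ : Measure ℝ} [IsProbabilityMeasure μ]
    (hμ : ∀ᵐ t ∂μ, t ∈ Icc (0 : ℝ) 1) (h : ∀ n : ℕ, ∫ t, t ^ n ∂μ = fpSeq n) : μ {1} = 0 := by
  have hle (n : ℕ) : μ.real {1} ≤ fpSeq n := by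
    rw [← h n, ← integral_indicator_one (measurableSet_singleton 1)]
    refine integral_mono_ae ((integrable_const 1).indicator (measurableSet_singleton 1))
      (integrable_of_continuous_of_ae_mem_Icc hμ (by fun_prop)) ?_
    filter_upwards [hμ] with t ht
    by_cases h1 : t = 1
    · simp [h1]
    · simpa [h1] using pow_nonneg ht.1 n
  have : μ.real {1} = 0 := le_antisymm (ge_of_tendsto' tendsto_fpSeq hle) measureReal_nonneg
  simpa [Measure.real, ENNReal.toReal_eq_zero_iff] using this

/-- The relation `m n - m (n + 1) = m n * m (n + 1) ^ 2` between moments, in integrated form. -/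
theorem integral_eval_mul_one_sub {μ : Measure ℝ} [IsProbabilityMeasure μ]
    (hμ : ∀ᵐ t ∂μ, t ∈ Icc (0 : ℝ) 1) (h : ∀ n : ℕ, ∫ t, t ^ n ∂μ = fpSeq n)
    (hP : ∀ f : ℝ × ℝ × ℝ → ℝ, Continuous f → Integrable f (μ.prod (μ.prod μ))) (p : ℝ[X]) :
    ∫ t, p.eval t * (1 - t) ∂μ =
      ∫ z, p.eval (z.1 * (z.2.1 * z.2.2)) * (z.2.1 * z.2.2) ∂(μ.prod (μ.prod μ)) := by
  induction p using Polynomial.induction_on' with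
  | add p q hp hq =>
    simp only [eval_add, add_mul]
    rw [integral_add, integral_add, hp, hq] <;>
      first
      | exact hP _ (by fun_prop)
      | exact integrable_of_continuous_of_ae_mem_Icc hμ (by fun_prop)
  | monomial n c =>
    have hl : ∫ t, c * t ^ n * (1 - t) ∂μ = c * (fpSeq n - fpSeq (n + 1)) := by
      rw [← h n, ← h (n + 1), ← integral_sub, ← integral_const_mul]
      · congr 1 with t
        ring
      all_goals exact integrable_of_continuous_of_ae_mem_Icc hμ (by fun_prop)
    have hr (z : ℝ × ℝ × ℝ) : c * (z.1 * (z.2.1 * z.2.2)) ^ n * (z.2.1 * z.2.2) =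
        c * (z.1 ^ n * (z.2.1 ^ (n + 1) * z.2.2 ^ (n + 1))) := by ring
    simp only [eval_monomial, hr]
    rw [hl, fpSeq_sub_succ, integral_const_mul,
      integral_prod_mul (μ := μ) (ν := μ.prod μ) (fun x => x ^ n)
        (fun y => y.1 ^ (n + 1) * y.2 ^ (n + 1)),
      integral_prod_mul (μ := μ) (ν := μ) (fun x => x ^ (n + 1)) (fun x => x ^ (n + 1)), h, h]

theorem tendsto_one_sub_pow_indicator {t : ℝ} (ht : t ∈ Icc (0 : ℝ) 1) :
    Tendsto (fun k : ℕ => (1 - t) ^ k) atTop (𝓝 (({0} : Set ℝ).indicator 1 t)) := by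
  rcases eq_or_ne t 0 with rfl | h0
  · simp
  · have hpos : 0 < t := lt_of_le_of_ne ht.1 h0.symm
    simpa [h0] using tendsto_pow_atTop_nhds_zero_of_lt_one (r := 1 - t)
      (by linarith [ht.2]) (by linarith)

theorem measure_singleton_zero_eq_zero {μ : Measure ℝ} [IsProbabilityMeasure μ]
    (hμ : ∀ᵐ t ∂μ, t ∈ Icc (0 : ℝ) 1) (h : ∀ n : ℕ, ∫ t, t ^ n ∂μ = fpSeq n) : μ {0} = 0 := by
  set P := μ.prod (μ.prod μ) with hPdef
  have hPmem : ∀ᵐ z ∂P, z ∈ Icc (0 : ℝ) 1 ×ˢ (Icc (0 : ℝ) 1 ×ˢ Icc (0 : ℝ) 1) := by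
    have h1 : ∀ᵐ z ∂P, z.1 ∈ Icc (0 : ℝ) 1 := Measure.quasiMeasurePreserving_fst.ae hμ
    have h2 : ∀ᵐ z ∂P, z.2.1 ∈ Icc (0 : ℝ) 1 :=
      Measure.quasiMeasurePreserving_snd.ae (Measure.quasiMeasurePreserving_fst.ae hμ)
    have h3 : ∀ᵐ z ∂P, z.2.2 ∈ Icc (0 : ℝ) 1 :=
      Measure.quasiMeasurePreserving_snd.ae (Measure.quasiMeasurePreserving_snd.ae hμ)
    filter_upwards [h1, h2, h3] with z h1 h2 h3
    exact ⟨h1, h2, h3⟩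
  have hP (f : ℝ × ℝ × ℝ → ℝ) (hf : Continuous f) : Integrable f P := by
    rw [← Measure.restrict_eq_self_of_ae_mem hPmem]
    exact hf.continuousOn.integrableOn_compact
      (isCompact_Icc.prod (isCompact_Icc.prod isCompact_Icc))
  have hident (k : ℕ) : ∫ t, (1 - t) ^ k * (1 - t) ∂μ =
      ∫ z, (1 - z.1 * (z.2.1 * z.2.2)) ^ k * (z.2.1 * z.2.2) ∂P := by
    have heval (s : ℝ) : ((1 - X : ℝ[X]) ^ k).eval s = (1 - s) ^ k := by simp
    simp_rw [← heval]
    exact integral_eval_mul_one_sub hμ h hP ((1 - X) ^ k)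
  have hleft : Tendsto (fun k : ℕ => ∫ t, (1 - t) ^ k * (1 - t) ∂μ) atTop (𝓝 (μ.real {0})) := by
    rw [← integral_indicator_one (measurableSet_singleton 0)]
    refine tendsto_integral_of_dominated_convergence (fun _ => 1)
      (fun k => by fun_prop) (integrable_const _) (fun k => ?_) ?_
    · filter_upwards [hμ] with t ht
      rw [← pow_succ, norm_pow, Real.norm_of_nonneg (by linarith [ht.2])]
      exact pow_le_one₀ (by linarith [ht.2]) (by linarith [ht.1])
    · filter_upwards [hμ] with t ht
      simp_rw [← pow_succ]
      exact (tendsto_one_sub_pow_indicator ht).comp (tendsto_add_atTop_nat 1)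
  have hright : Tendsto (fun k : ℕ =>
      ∫ z, (1 - z.1 * (z.2.1 * z.2.2)) ^ k * (z.2.1 * z.2.2) ∂P) atTop
      (𝓝 (μ.real {0} * (fpSeq 1 * fpSeq 1))) := by
    have hval : ∫ z, ({0} : Set ℝ).indicator 1 z.1 * (z.2.1 * z.2.2) ∂P =
        μ.real {0} * (fpSeq 1 * fpSeq 1) := by
      have h1 : ∫ t, t ∂μ = fpSeq 1 := by simpa using h 1
      rw [hPdef, integral_prod_mul (μ := μ) (ν := μ.prod μ) (({0} : Set ℝ).indicator 1)
          (fun y => y.1 * y.2),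
        integral_prod_mul (μ := μ) (ν := μ) (fun x => x) (fun x => x), h1,
        integral_indicator_one (measurableSet_singleton 0)]
    rw [← hval]
    refine tendsto_integral_of_dominated_convergence (fun _ => 1)
      (fun k => by fun_prop) (integrable_const _) (fun k => ?_) ?_
    · filter_upwards [hPmem] with z hz
      have hyz := unitInterval.mul_mem hz.2.1 hz.2.2
      have hxyz := unitInterval.mul_mem hz.1 hyz
      rw [norm_mul, norm_pow, Real.norm_of_nonneg (by linarith [hxyz.2]),
        Real.norm_of_nonneg hyz.1]
      exact mul_le_one₀ (pow_le_one₀ (by linarith [hxyz.2]) (by linarith [hxyz.1])) hyz.1 hyz.2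
    · filter_upwards [hPmem] with z hz
      have hyz := unitInterval.mul_mem hz.2.1 hz.2.2
      have hlim := (tendsto_one_sub_pow_indicator (unitInterval.mul_mem hz.1 hyz)).mul_const
        (z.2.1 * z.2.2)
      convert hlim using 2
      by_cases hy : z.2.1 * z.2.2 = 0
      · simp [hy]
      · by_cases hx : z.1 = 0 <;> simp_all [Set.indicator]
  have heq : μ.real {0} = μ.real {0} * (fpSeq 1 * fpSeq 1) :=
    tendsto_nhds_unique hleft (by simpa only [hident] using hright)
  have hlt : fpSeq 1 * fpSeq 1 < 1 := by nlinarith [fpSeq_pos 1, fpSeq_one_lt_one]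
  have : μ.real {0} = 0 := by
    have : μ.real {0} * (1 - fpSeq 1 * fpSeq 1) = 0 := by linear_combination heq
    exact (mul_eq_zero.1 this).resolve_right (by linarith)
  simpa [Measure.real, ENNReal.toReal_eq_zero_iff] using this

theorem stmt_0 :
    (∃! μ : Measure ℝ, IsProbabilityMeasure μ ∧ μ (Set.Icc (0:ℝ) 1)ᶜ = 0 ∧
        ∀ n : ℕ, ∫ t in Set.Icc (0:ℝ) 1, t ^ n ∂μ = fpSeq n) ∧
    (∀ μ : Measure ℝ, IsProbabilityMeasure μ → μ (Set.Icc (0:ℝ) 1)ᶜ = 0 →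
        (∀ n : ℕ, ∫ t in Set.Icc (0:ℝ) 1, t ^ n ∂μ = fpSeq n) →
        μ {0} = 0 ∧ μ {1} = 0) := by
  have hmom {μ : Measure ℝ} (hμ : μ (Set.Icc (0:ℝ) 1)ᶜ = 0)
      (h : ∀ n : ℕ, ∫ t in Set.Icc (0:ℝ) 1, t ^ n ∂μ = fpSeq n) (n : ℕ) :
      ∫ t, t ^ n ∂μ = fpSeq n := by
    have hae : ∀ᵐ t ∂μ, t ∈ Icc (0 : ℝ) 1 := mem_ae_iff.2 hμ
    rw [← h n, Measure.restrict_eq_self_of_ae_mem hae]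
  constructor
  · obtain ⟨ν, hν⟩ := exists_probabilityMeasure_moments fpSeq_isMonotoneOfOrder rfl
    have hmeas : Measurable (Subtype.val : I → ℝ) := measurable_subtype_coe
    have hcompl : (Measure.map Subtype.val (ν : Measure I)) (Set.Icc (0:ℝ) 1)ᶜ = 0 := by
      rw [Measure.map_apply hmeas measurableSet_Icc.compl]
      simp
    have hae : ∀ᵐ t ∂(Measure.map Subtype.val (ν : Measure I)), t ∈ Icc (0 : ℝ) 1 :=
      mem_ae_iff.2 hcompl
    refine ⟨Measure.map Subtype.val (ν : Measure I),
      ⟨Measure.isProbabilityMeasure_map hmeas.aemeasurable, hcompl, fun n => ?_⟩, ?_⟩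
    · rw [Measure.restrict_eq_self_of_ae_mem hae,
        integral_map hmeas.aemeasurable (by fun_prop), hν n]
    · rintro μ ⟨hprob, hμ, hm⟩
      have := Measure.isProbabilityMeasure_map (μ := (ν : Measure I)) hmeas.aemeasurable
      refine eq_of_integral_pow_eq (mem_ae_iff.2 hμ) hae fun n => ?_
      rw [hmom hμ hm n, integral_map hmeas.aemeasurable (by fun_prop), hν n]
  · intro μ hprob hμ hm
    exact ⟨measure_singleton_zero_eq_zero (mem_ae_iff.2 hμ) (hmom hμ hm),
      measure_singleton_one_eq_zero (mem_ae_iff.2 hμ) (hmom hμ hm)⟩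
end

section
/- Let f̃ : (0,∞) → (0,∞) satisfy: (i) f̃(1) = 1; (ii) s ↦ log(1/f̃(s)) is convex; (iii) f̃(s) = f̃(s+1) − 1/f̃(s+1) for all s > 0. Then for every s with 0 < s ≤ 1 the limit lim_{n→∞} ψ^{∘n}( λ_n (λ_{n+1}/λ_n)^s ) exists and equals f̃(s). In particular, any two functions (0,∞) → (0,∞) satisfying (i)–(iii) are equal. -/
open MeasureTheory Set Filter

/-- The sequence `λ₀ = 0`, `λ_{n+1} = (λₙ + √(λₙ² + 4))/2`. -/
noncomputable def lamSeq : ℕ → ℝ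
  | 0 => 0
  | n + 1 => (lamSeq n + Real.sqrt (lamSeq n ^ 2 + 4)) / 2

/-- The rational function `ψ(x) = x - 1/x`. -/
noncomputable def psi (x : ℝ) : ℝ := x - 1 / x

theorem lamSeq_nonneg (n : ℕ) : 0 ≤ lamSeq n := by
  induction n with
  | zero => simp [lamSeq]
  | succ n ih =>
    rw [lamSeq]
    positivity

theorem lamSeq_succ_pos (n : ℕ) : 0 < lamSeq (n + 1) := by
  have := lamSeq_nonneg n
  rw [lamSeq]
  positivity

theorem lamSeq_succ_sq (n : ℕ) : lamSeq (n + 1) ^ 2 = lamSeq n * lamSeq (n + 1) + 1 := by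
  have h := Real.sq_sqrt (show 0 ≤ lamSeq n ^ 2 + 4 by positivity)
  rw [lamSeq]
  linear_combination h / 4

theorem lamSeq_one : lamSeq 1 = 1 := by
  have h := lamSeq_succ_sq 0
  have hp := lamSeq_succ_pos 0
  have h0 : lamSeq 0 = 0 := rfl
  rw [h0] at h
  norm_num at h hp
  rcases h with h | h <;> linarith

theorem psi_lamSeq_succ (n : ℕ) : psi (lamSeq (n + 1)) = lamSeq n := by
  have h := lamSeq_succ_sq n
  have hp := lamSeq_succ_pos n
  rw [psi]
  field_simp
  linarith

theorem lamSeq_le_succ (n : ℕ) : lamSeq n ≤ lamSeq (n + 1) := by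
  have h := lamSeq_succ_sq n
  have hp := lamSeq_succ_pos n
  nlinarith

theorem lamSeq_div_lamSeq (n : ℕ) :
    lamSeq (n + 2) / lamSeq (n + 1) = 1 + 1 / (lamSeq (n + 1) * lamSeq (n + 2)) := by
  have h := lamSeq_succ_sq (n + 1)
  have hp := lamSeq_succ_pos n
  have hq := lamSeq_succ_pos (n + 1)
  field_simp
  linarith

theorem natCast_le_lamSeq_sq (n : ℕ) : (n : ℝ) ≤ lamSeq n ^ 2 := by
  induction n with
  | zero => simp [lamSeq]
  | succ n ih =>
    have h := lamSeq_succ_sq n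
    have hm := lamSeq_le_succ n
    have h0 := lamSeq_nonneg n
    push_cast
    nlinarith

theorem psi_sub_psi {x y : ℝ} (hx : 0 < x) (hy : 0 < y) :
    psi y - psi x = (y - x) * (1 + 1 / (x * y)) := by
  unfold psi
  field_simp
  ring

theorem psi_le_psi {x y : ℝ} (hx : 0 < x) (hxy : x ≤ y) : psi x ≤ psi y := by
  have h := psi_sub_psi hx (hx.trans_le hxy)
  have : 0 ≤ (y - x) * (1 + 1 / (x * y)) :=
    mul_nonneg (sub_nonneg.2 hxy) (by have := hx.trans_le hxy; positivity)
  linarith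

theorem psi_injOn_pos : InjOn psi (Ioi 0) := by
  intro x hx y hy h
  have hx : 0 < x := hx
  have hy : 0 < y := hy
  have e := psi_sub_psi hx hy
  rw [h, sub_self] at e
  have : (1 + 1 / (x * y)) ≠ 0 := by positivity
  have := (mul_eq_zero.1 e.symm).resolve_right this
  linarith

theorem psi_sub_psi_le {c x y : ℝ} (hc : 0 < c) (hx : c ≤ x) (hxy : x ≤ y) :
    psi y - psi x ≤ (y - x) * (1 + 1 / c ^ 2) := by
  have hx0 := hc.trans_le hx
  rw [psi_sub_psi hx0 (hx0.trans_le hxy)]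
  have : c ^ 2 ≤ x * y := by nlinarith
  have h2 : 1 / (x * y) ≤ 1 / c ^ 2 := one_div_le_one_div_of_le (by positivity) this
  have := sub_nonneg.2 hxy
  gcongr

theorem iterate_psi_sub_bounds (n : ℕ) {x y : ℝ} (hx : lamSeq (n + 1) ≤ x) (hxy : x ≤ y) :
    0 ≤ psi^[n + 1] y - psi^[n + 1] x ∧
      psi^[n + 1] y - psi^[n + 1] x ≤ 2 * lamSeq (n + 1) * (y - x) := by
  induction n generalizing x y with
  | zero =>
    have hp := lamSeq_succ_pos 0
    have h := psi_sub_psi_le hp hx hxy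
    have h' := psi_le_psi (hp.trans_le hx) hxy
    simp only [zero_add, lamSeq_one, Function.iterate_one] at *
    constructor <;> linarith
  | succ n ih =>
    have hp := lamSeq_succ_pos (n + 1)
    have hq := lamSeq_succ_pos n
    have h := psi_sub_psi_le hp hx hxy
    have h' := psi_le_psi (hp.trans_le hx) hxy
    have hl : lamSeq (n + 1) ≤ psi x := by
      rw [← psi_lamSeq_succ (n + 1)]
      exact psi_le_psi hp hx
    obtain ⟨i1, i2⟩ := ih hl h'
    rw [Function.iterate_succ_apply _ (n + 1), Function.iterate_succ_apply _ (n + 1)]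
    refine ⟨i1, i2.trans ?_⟩
    have key : lamSeq (n + 1) * (1 + 1 / lamSeq (n + 2) ^ 2) ≤ lamSeq (n + 2) := by
      have e := lamSeq_succ_sq (n + 1)
      have m := lamSeq_le_succ (n + 1)
      have : lamSeq (n + 2) - lamSeq (n + 1) * (1 + 1 / lamSeq (n + 2) ^ 2)
          = (lamSeq (n + 2) - lamSeq (n + 1)) / lamSeq (n + 2) ^ 2 := by
        field_simp
        linear_combination lamSeq (n + 2) * e
      have : 0 ≤ (lamSeq (n + 2) - lamSeq (n + 1)) / lamSeq (n + 2) ^ 2 :=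
        div_nonneg (sub_nonneg.2 m) (by positivity)
      linarith
    calc 2 * lamSeq (n + 1) * (psi y - psi x)
        ≤ 2 * lamSeq (n + 1) * ((y - x) * (1 + 1 / lamSeq (n + 2) ^ 2)) := by gcongr
      _ = 2 * (lamSeq (n + 1) * (1 + 1 / lamSeq (n + 2) ^ 2)) * (y - x) := by ring
      _ ≤ 2 * lamSeq (n + 2) * (y - x) := by
        have := sub_nonneg.2 hxy
        gcongr

theorem rpow_sub_rpow_le_sub {a b s : ℝ} (hb : 1 ≤ b) (hab : b ≤ a) (hs1 : s ≤ 1) :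
    a ^ s - b ^ s ≤ a - b := by
  have hb0 : 0 < b := by linarith
  have h1 : 1 ≤ a / b := (one_le_div hb0).2 hab
  have e : a ^ s = b ^ s * (a / b) ^ s := by
    rw [← Real.mul_rpow hb0.le (by positivity), mul_div_cancel₀ _ hb0.ne']
  have h2 : (a / b) ^ s ≤ a / b := Real.rpow_le_self_of_one_le h1 hs1
  have h3 : b ^ s ≤ b := Real.rpow_le_self_of_one_le hb hs1
  have h4 : 0 ≤ b ^ s := by positivity
  calc a ^ s - b ^ s = b ^ s * ((a / b) ^ s - 1) := by rw [e]; ring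
    _ ≤ b ^ s * (a / b - 1) := by gcongr
    _ ≤ b * (a / b - 1) := by
      have := sub_nonneg.2 h1
      gcongr
    _ = a - b := by field_simp

section Interpolation

variable {f : ℝ → ℝ}

theorem eq_lamSeq_of_psi_eq (hpos : ∀ s : ℝ, 0 < s → 0 < f s) (h1 : f 1 = 1)
    (hfe : ∀ s : ℝ, 0 < s → f s = psi (f (s + 1))) (n : ℕ) :
    f ((n + 1 : ℕ) : ℝ) = lamSeq (n + 1) := by
  induction n with
  | zero => simp [h1, lamSeq_one]
  | succ n ih =>
    apply psi_injOn_pos (hpos _ (by positivity)) (lamSeq_succ_pos _)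
    rw [psi_lamSeq_succ, ← ih, hfe _ (by positivity : (0 : ℝ) < (n + 1 : ℕ))]
    push_cast
    rfl

theorem iterate_psi_apply_add (hfe : ∀ s : ℝ, 0 < s → f s = psi (f (s + 1))) (n : ℕ) {s : ℝ}
    (hs : 0 < s) : psi^[n] (f (n + s)) = f s := by
  induction n generalizing s with
  | zero => simp
  | succ n ih =>
    rw [Function.iterate_succ_apply', hfe s hs, ← ih (by linarith : 0 < s + 1)]
    push_cast
    ring_nf

theorem le_apply_add_of_logConcave (hpos : ∀ s : ℝ, 0 < s → 0 < f s)
    (hconv : ConvexOn ℝ (Ioi (0 : ℝ)) (fun s => Real.log (1 / f s)))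
    {t s : ℝ} (ht : 0 < t) (hs0 : 0 < s) (hs1 : s ≤ 1) :
    f t * (f (t + 1) / f t) ^ s ≤ f (t + s) := by
  have p0 := hpos t ht
  have p1 := hpos (t + 1) (by linarith)
  have p2 := hpos (t + s) (by linarith)
  have h := hconv.2 (show t ∈ Ioi (0 : ℝ) from ht) (show t + 1 ∈ Ioi (0 : ℝ) from by
    simp only [mem_Ioi]; linarith) (sub_nonneg.2 hs1) hs0.le (by ring)
  simp only [smul_eq_mul, one_div, Real.log_inv] at h
  rw [show (1 - s) * t + s * (t + 1) = t + s by ring] at h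
  rw [← Real.log_le_log_iff (by positivity) p2, Real.log_mul p0.ne' (by positivity),
    Real.log_rpow (by positivity), Real.log_div p1.ne' p0.ne']
  linarith

theorem apply_add_le_of_logConcave (hpos : ∀ s : ℝ, 0 < s → 0 < f s)
    (hconv : ConvexOn ℝ (Ioi (0 : ℝ)) (fun s => Real.log (1 / f s)))
    {t s : ℝ} (ht : 0 < t) (hs0 : 0 < s) :
    f (t + 1 + s) ≤ f (t + 1) * (f (t + 1) / f t) ^ s := by
  have p0 := hpos t ht
  have p1 := hpos (t + 1) (by linarith)
  have p2 := hpos (t + 1 + s) (by linarith)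
  have h := hconv.2 (show t ∈ Ioi (0 : ℝ) from ht) (show t + 1 + s ∈ Ioi (0 : ℝ) from by
    simp only [mem_Ioi]; linarith) (show 0 ≤ s / (1 + s) by positivity)
    (show 0 ≤ 1 / (1 + s) by positivity) (by field_simp; ring)
  simp only [smul_eq_mul] at h
  rw [show s / (1 + s) * t + 1 / (1 + s) * (t + 1 + s) = t + 1 by field_simp; ring] at h
  simp only [one_div, Real.log_inv] at h
  have h' := mul_le_mul_of_nonneg_left h (show 0 ≤ 1 + s by positivity)
  rw [show (1 + s) * (s / (1 + s) * -Real.log (f t) + (1 + s)⁻¹ * -Real.log (f (t + 1 + s)))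
    = -(s * Real.log (f t)) - Real.log (f (t + 1 + s)) by field_simp; ring] at h'
  rw [← Real.log_le_log_iff p2 (by positivity), Real.log_mul p1.ne' (by positivity),
    Real.log_rpow (by positivity), Real.log_div p1.ne' p0.ne']
  linarith

theorem iterate_psi_error_bounds (hpos : ∀ s : ℝ, 0 < s → 0 < f s) (h1 : f 1 = 1)
    (hconv : ConvexOn ℝ (Ioi (0 : ℝ)) (fun s => Real.log (1 / f s)))
    (hfe : ∀ s : ℝ, 0 < s → f s = psi (f (s + 1))) {s : ℝ} (hs0 : 0 < s) (hs1 : s ≤ 1) (n : ℕ) :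
    0 ≤ f s - psi^[n + 2] (lamSeq (n + 2) * (lamSeq (n + 3) / lamSeq (n + 2)) ^ s) ∧
      f s - psi^[n + 2] (lamSeq (n + 2) * (lamSeq (n + 3) / lamSeq (n + 2)) ^ s) ≤
        4 * (1 / ((n : ℝ) + 1)) := by
  set a := lamSeq (n + 1)
  set b := lamSeq (n + 2)
  set c := lamSeq (n + 3)
  have a0 : 0 < a := lamSeq_succ_pos n
  have b0 : 0 < b := lamSeq_succ_pos (n + 1)
  have c0 : 0 < c := lamSeq_succ_pos (n + 2)
  have hab : a ≤ b := lamSeq_le_succ _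
  have hbc : b ≤ c := lamSeq_le_succ _
  have fa : f ((n : ℝ) + 1) = a := by simpa using eq_lamSeq_of_psi_eq hpos h1 hfe n
  have fb : f ((n : ℝ) + 1 + 1) = b := by simpa using eq_lamSeq_of_psi_eq hpos h1 hfe (n + 1)
  have fc : f ((n : ℝ) + 1 + 1 + 1) = c := by
    simpa using eq_lamSeq_of_psi_eq hpos h1 hfe (n + 1 + 1)
  have lower := le_apply_add_of_logConcave hpos hconv (t := (n : ℝ) + 1 + 1) (by positivity) hs0 hs1
  have upper := apply_add_le_of_logConcave hpos hconv (t := (n : ℝ) + 1) (by positivity) hs0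
  rw [fb, fc] at lower
  rw [fa, fb] at upper
  have hbx : b ≤ b * (c / b) ^ s :=
    le_mul_of_one_le_right b0.le (Real.one_le_rpow ((one_le_div b0).2 hbc) hs0.le)
  obtain ⟨i1, i2⟩ := iterate_psi_sub_bounds (n + 1) hbx lower
  have it : psi^[n + 1 + 1] (f ((n : ℝ) + 1 + 1 + s)) = f s := by
    simpa using iterate_psi_apply_add hfe (n + 1 + 1) hs0
  rw [it] at i1 i2
  refine ⟨i1, i2.trans ?_⟩
  have rab : b / a = 1 + 1 / (a * b) := lamSeq_div_lamSeq n
  have rbc : c / b = 1 + 1 / (b * c) := lamSeq_div_lamSeq (n + 1)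
  have hratio : c / b ≤ b / a := by
    rw [rab, rbc]
    have : a * b ≤ b * c := by nlinarith
    gcongr
  have hpow := rpow_sub_rpow_le_sub ((one_le_div b0).2 hbc) hratio hs1
  have hc2 : c ^ 2 = b * c + 1 := lamSeq_succ_sq (n + 2)
  have hn : (n : ℝ) + 1 ≤ a ^ 2 := by simpa using natCast_le_lamSeq_sq (n + 1)
  have hac : b / c = 1 - 1 / c ^ 2 := by
    field_simp
    linarith
  have hdiff : f ((n : ℝ) + 1 + 1 + s) - b * (c / b) ^ s ≤ b * (b / a - c / b) := by
    have := mul_le_mul_of_nonneg_left hpow b0.le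
    linarith
  calc 2 * b * (f ((n : ℝ) + 1 + 1 + s) - b * (c / b) ^ s)
      ≤ 2 * b * (b * (b / a - c / b)) := by gcongr
    _ = 2 * (b / a - b / c) := by
      have : b / a - c / b = 1 / (a * b) - 1 / (b * c) := by rw [rab, rbc]; ring
      rw [this]
      field_simp
    _ = 2 * (1 / (a * b) + 1 / c ^ 2) := by rw [rab, hac]; ring
    _ ≤ 2 * (1 / ((n : ℝ) + 1) + 1 / ((n : ℝ) + 1)) := by
      have h1 : (n : ℝ) + 1 ≤ a * b := by nlinarith
      have h2 : (n : ℝ) + 1 ≤ c ^ 2 := by nlinarith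
      gcongr
    _ = 4 * (1 / ((n : ℝ) + 1)) := by ring

theorem tendsto_iterate_psi (hpos : ∀ s : ℝ, 0 < s → 0 < f s) (h1 : f 1 = 1)
    (hconv : ConvexOn ℝ (Ioi (0 : ℝ)) (fun s => Real.log (1 / f s)))
    (hfe : ∀ s : ℝ, 0 < s → f s = psi (f (s + 1))) {s : ℝ} (hs0 : 0 < s) (hs1 : s ≤ 1) :
    Tendsto (fun n : ℕ => psi^[n] (lamSeq n * (lamSeq (n + 1) / lamSeq n) ^ s))
      atTop (nhds (f s)) := by
  rw [← tendsto_add_atTop_iff_nat 2]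
  have hlim : Tendsto (fun n : ℕ => 4 * (1 / ((n : ℝ) + 1))) atTop (nhds 0) := by
    simpa using (tendsto_one_div_add_atTop_nhds_zero_nat (𝕜 := ℝ)).const_mul 4
  have h := squeeze_zero (fun n => (iterate_psi_error_bounds hpos h1 hconv hfe hs0 hs1 n).1)
    (fun n => (iterate_psi_error_bounds hpos h1 hconv hfe hs0 hs1 n).2) hlim
  simpa using h.const_sub (f s)

end Interpolation

theorem eqOn_pos_of_psi_eq {f g : ℝ → ℝ} (hf : ∀ s : ℝ, 0 < s → 0 < f s)
    (hg : ∀ s : ℝ, 0 < s → 0 < g s) (hfe : ∀ s : ℝ, 0 < s → f s = psi (f (s + 1)))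
    (hge : ∀ s : ℝ, 0 < s → g s = psi (g (s + 1)))
    (h : ∀ s : ℝ, 0 < s → s ≤ 1 → g s = f s) {s : ℝ} (hs : 0 < s) : g s = f s := by
  obtain ⟨n, hn⟩ := exists_nat_ge s
  induction n generalizing s with
  | zero => exact absurd hn (by simpa using hs)
  | succ n ih =>
    rcases le_or_gt s 1 with h' | h'
    · exact h s hs h'
    · have hs' : 0 < s - 1 := by linarith
      have e := ih hs' (by push_cast at hn; linarith)
      rw [hge _ hs', hfe _ hs', sub_add_cancel] at e
      exact psi_injOn_pos (hg s hs) (hf s hs) e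

theorem stmt_5 (ftilde : ℝ → ℝ)
    (hpos : ∀ s : ℝ, 0 < s → 0 < ftilde s)
    (h1 : ftilde 1 = 1)
    (hconv : ConvexOn ℝ (Set.Ioi (0:ℝ)) (fun s => Real.log (1 / ftilde s)))
    (hfe : ∀ s : ℝ, 0 < s → ftilde s = ftilde (s + 1) - 1 / ftilde (s + 1)) :
    (∀ s : ℝ, 0 < s → s ≤ 1 →
      Tendsto (fun n : ℕ => psi^[n] (lamSeq n * (lamSeq (n + 1) / lamSeq n) ^ s))
        atTop (nhds (ftilde s))) ∧
    ∀ g : ℝ → ℝ, (∀ s : ℝ, 0 < s → 0 < g s) → g 1 = 1 →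
      ConvexOn ℝ (Set.Ioi (0:ℝ)) (fun s => Real.log (1 / g s)) →
      (∀ s : ℝ, 0 < s → g s = g (s + 1) - 1 / g (s + 1)) →
      ∀ s : ℝ, 0 < s → g s = ftilde s := by
  have key : ∀ s : ℝ, 0 < s → s ≤ 1 →
      Tendsto (fun n : ℕ => psi^[n] (lamSeq n * (lamSeq (n + 1) / lamSeq n) ^ s))
        atTop (nhds (ftilde s)) :=
    fun s hs0 hs1 => tendsto_iterate_psi hpos h1 hconv hfe hs0 hs1
  refine ⟨key, fun g gpos g1 gconv gfe s hs => ?_⟩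
  exact eqOn_pos_of_psi_eq hpos gpos hfe gfe (fun t ht0 ht1 =>
    tendsto_nhds_unique (tendsto_iterate_psi gpos g1 gconv gfe ht0 ht1) (key t ht0 ht1)) hs
end
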